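/- arXiv:0902.0630 — 3 statements merged into one kernel-verified Lean document; each statement's English description precedes it below -/
import Mathlib

section
/- Let (Ω, F, P) be a probability space, b a real number, and h(t) : Ω → ℝ an integrable random variable for each t ∈ ℕ. Let U(t) : Ω → ℝ be defined pointwise by U(0) = 0 and U(t+1) = max(U(t) + h(t) − b, 0). If E[U(t)]/t → 0 as t → ∞, then limsup_{t→∞} (1/t) Σ_{τ=0}^{t−1} E[h(τ)] ≤ b. -/
open MeasureTheory Filter

theorem stmt_1 {Ω : Type*} [MeasurableSpace Ω] (P : Measure Ω) [IsProbabilityMeasure P]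
    (b : ℝ) (h : ℕ → Ω → ℝ) (hint : ∀ t, Integrable (h t) P)
    (U : ℕ → Ω → ℝ) (hU0 : ∀ ω, U 0 ω = 0)
    (hrec : ∀ t ω, U (t + 1) ω = max (U t ω + h t ω - b) 0)
    (hstab : Tendsto (fun t : ℕ => (∫ ω, U t ω ∂P) / t) atTop (nhds 0)) :
    limsup
        (fun t : ℕ =>
          ((((1 : ℝ) / t) * ∑ τ ∈ Finset.range t, ∫ ω, h τ ω ∂P : ℝ) : EReal))
        atTop ≤ (b : EReal) := by
  have hUint : ∀ t, Integrable (U t) P := by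
    intro t
    induction t with
    | zero =>
      have : U 0 = fun _ => 0 := funext hU0
      rw [this]
      exact integrable_zero _ _ _
    | succ t ih =>
      have : U (t + 1) = fun ω => max (U t ω + h t ω - b) 0 := funext (hrec t)
      rw [this]
      exact ((ih.add (hint t)).sub (integrable_const b)).pos_part
  have hsum : ∀ t : ℕ, ∑ τ ∈ Finset.range t, ∫ ω, h τ ω ∂P ≤ (∫ ω, U t ω ∂P) + t * b := by
    intro t
    induction t with
    | zero => simp [hU0]
    | succ t ih =>
      have h1 : ∫ ω, (U t ω + h t ω - b) ∂P ≤ ∫ ω, U (t + 1) ω ∂P := by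
        refine integral_mono (((hUint t).add (hint t)).sub (integrable_const b))
          (hUint (t + 1)) ?_
        intro ω
        show U t ω + h t ω - b ≤ U (t + 1) ω
        rw [hrec]
        exact le_max_left _ _
      have h2 : ∫ ω, (U t ω + h t ω - b) ∂P = ∫ ω, U t ω ∂P + ∫ ω, h t ω ∂P - b := by
        have e1 := integral_sub ((hUint t).add (hint t)) (integrable_const (μ := P) b)
        have e2 := integral_add (hUint t) (hint t)
        simp only [Pi.add_apply] at e1
        rw [e1, e2]
        simp
      rw [Finset.sum_range_succ]
      push_cast
      linarith
  have hlim : Tendsto (fun t : ℕ => (((∫ ω, U t ω ∂P) / t + b : ℝ) : EReal)) atTop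
      (nhds (b : EReal)) := by
    have := hstab.add_const b
    rw [zero_add] at this
    exact (continuous_coe_real_ereal.tendsto b).comp this
  rw [← hlim.limsup_eq]
  refine limsup_le_limsup ?_
  filter_upwards [eventually_gt_atTop 0] with t ht
  have ht' : (0 : ℝ) < t := by exact_mod_cast ht
  rw [EReal.coe_le_coe_iff]
  calc (1 : ℝ) / t * ∑ τ ∈ Finset.range t, ∫ ω, h τ ω ∂P
      ≤ 1 / t * ((∫ ω, U t ω ∂P) + t * b) :=
        mul_le_mul_of_nonneg_left (hsum t) (by positivity)
    _ = (∫ ω, U t ω ∂P) / t + b := by field_simp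
end

section
/- Let a : ℕ → ℝ be a sequence with a(t) ≥ 0 for all t, and suppose there is a constant d ≥ 0 with |a(t+1) − a(t)| ≤ d for all t. If limsup_{t→∞} (1/t) Σ_{τ=0}^{t−1} a(τ) < ∞, then a(t)/t → 0 as t → ∞. -/
open Filter

theorem stmt_3 (a : ℕ → ℝ) (ha : ∀ t, 0 ≤ a t)
    (d : ℝ) (hd : 0 ≤ d) (hstep : ∀ t, |a (t + 1) - a t| ≤ d)
    (hbdd :
      limsup (fun t : ℕ => ((((1 : ℝ) / t) * ∑ τ ∈ Finset.range t, a τ : ℝ) : EReal)) atTop < ⊤) :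
    Tendsto (fun t : ℕ => a t / t) atTop (nhds 0) := by
  have key : ∀ t, a t ^ 2 ≤ a 0 ^ 2 + 2 * d * ∑ τ ∈ Finset.range (t + 1), a τ := by
    have h : ∀ t, a t ^ 2 + d * a t ≤ a 0 ^ 2 + 2 * d * ∑ τ ∈ Finset.range (t + 1), a τ := by
      intro t
      induction t with
      | zero =>
        simp only [zero_add, Finset.sum_range_one]
        nlinarith [mul_nonneg hd (ha 0)]
      | succ k ih =>
        rw [Finset.sum_range_succ]
        have h1 := (abs_le.mp (hstep k)).2
        have h2 := mul_le_mul_of_nonneg_right h1 (add_nonneg (ha (k + 1)) (ha k))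
        nlinarith
    intro t
    have := h t
    have := mul_nonneg hd (ha t)
    linarith
  obtain ⟨M, hM1, hM2⟩ := EReal.lt_iff_exists_real_btwn.mp hbdd
  have hev := eventually_lt_of_limsup_lt hM1
  have hev' := (tendsto_add_atTop_nat 1).eventually hev
  have hC : ∀ᶠ t : ℕ in atTop, (a t / t) ^ 2 ≤ (a 0 ^ 2 + 4 * d * |M|) / t := by
    filter_upwards [hev', eventually_ge_atTop 1] with t ht h1
    have ht' := EReal.coe_lt_coe_iff.mp ht
    have h1' : (1 : ℝ) ≤ t := by exact_mod_cast h1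
    have hp : (0 : ℝ) < ((t + 1 : ℕ) : ℝ) := by positivity
    rw [one_div, inv_mul_lt_iff₀ hp] at ht'
    have hS : ∑ τ ∈ Finset.range (t + 1), a τ ≤ 2 * t * |M| := by
      refine ht'.le.trans ?_
      push_cast
      nlinarith [le_abs_self M, abs_nonneg M]
    have hk := key t
    have h3 := mul_le_mul_of_nonneg_left hS (mul_nonneg (zero_le_two (α := ℝ)) hd)
    rw [div_pow, div_le_div_iff₀ (by positivity) (by positivity)]
    have h4 : a t ^ 2 ≤ (a 0 ^ 2 + 4 * d * |M|) * t := by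
      nlinarith [sq_nonneg (a 0)]
    have := mul_le_mul_of_nonneg_right h4 (zero_le_one.trans h1')
    nlinarith
  have hsq : Tendsto (fun t : ℕ => (a t / t) ^ 2) atTop (nhds 0) :=
    squeeze_zero' (Eventually.of_forall fun t => sq_nonneg _) hC
      (tendsto_const_div_atTop_nhds_zero_nat _)
  have hs := hsq.sqrt
  rw [Real.sqrt_zero] at hs
  refine hs.congr fun t => ?_
  exact Real.sqrt_sq (div_nonneg (ha t) (Nat.cast_nonneg t))
end

section
/- Let t₀ < t be natural numbers, let L : ℕ → ℝ satisfy L(τ) ≥ 0 for all τ, and let V : ℕ → ℝ be positive and nondecreasing. Then Σ_{τ=t₀}^{t−1} (L(τ+1) − L(τ))/V(τ) ≥ −L(t₀)/V(t₀). -/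
theorem stmt_9 (t₀ t : ℕ) (h : t₀ < t) (L V : ℕ → ℝ)
    (hL : ∀ τ, 0 ≤ L τ) (hVpos : ∀ τ, 0 < V τ) (hVmono : Monotone V) :
    -(L t₀ / V t₀) ≤ ∑ τ ∈ Finset.Ico t₀ t, (L (τ + 1) - L τ) / V τ := by
  have key : ∀ s, t₀ ≤ s →
      L s / V s - L t₀ / V t₀ ≤ ∑ τ ∈ Finset.Ico t₀ s, (L (τ + 1) - L τ) / V τ := by
    intro s hs
    induction s, hs using Nat.le_induction with
    | base => simp
    | succ n hn ih =>
      rw [Finset.sum_Ico_succ_top hn, sub_div]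
      have h1 : L (n + 1) / V (n + 1) ≤ L (n + 1) / V n :=
        div_le_div_of_nonneg_left (hL _) (hVpos n) (hVmono (Nat.le_succ n))
      linarith
  have h1 := key t h.le
  have h2 : 0 ≤ L t / V t := div_nonneg (hL t) (hVpos t).le
  linarith
end
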